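/- For n ≥ 2, every element of Ŵ_{n,S} is an S-linear combination of elements of the form a·χ·b, where a and b lie in the subalgebra of Ŵ_{n,S} generated by x_1, x_1⁻¹ and {g_i, g_i⁻¹, e_i : 1 ≤ i ≤ n−2}, and χ ∈ {e_{n−1}, g_{n−1}, g_{n−1}⁻¹} ∪ {x_n^r : r ∈ ℤ}. -/

import Mathlib

namespace ABMW

/-- Generators of the affine Birman–Wenzl–Murakami algebra `Ŵ_{n,S}`:
`x₁`, `x₁⁻¹` and `g i`, `g i⁻¹`, `e i` for `1 ≤ i ≤ n - 1`. -/
inductive Gen (n : ℕ) : Type where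
  | x : Gen n
  | xi : Gen n
  | g (i : ℕ) (h : 1 ≤ i ∧ i < n) : Gen n
  | gi (i : ℕ) (h : 1 ≤ i ∧ i < n) : Gen n
  | e (i : ℕ) (h : 1 ≤ i ∧ i < n) : Gen n

variable (S : Type*) [CommRing S]

/-- The generator `x₁` in the free algebra. -/
noncomputable def FX (n : ℕ) : FreeAlgebra S (Gen n) := FreeAlgebra.ι S Gen.x

/-- The generator `x₁⁻¹` in the free algebra. -/
noncomputable def FXi (n : ℕ) : FreeAlgebra S (Gen n) := FreeAlgebra.ι S Gen.xi

/-- The generator `g i` in the free algebra (junk value `1` if `i` is out of range). -/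
noncomputable def FG (n i : ℕ) : FreeAlgebra S (Gen n) :=
  if h : 1 ≤ i ∧ i < n then FreeAlgebra.ι S (Gen.g i h) else 1

/-- The generator `g i⁻¹` in the free algebra (junk value `1` if `i` is out of range). -/
noncomputable def FGi (n i : ℕ) : FreeAlgebra S (Gen n) :=
  if h : 1 ≤ i ∧ i < n then FreeAlgebra.ι S (Gen.gi i h) else 1

/-- The generator `e i` in the free algebra (junk value `1` if `i` is out of range). -/
noncomputable def FE (n i : ℕ) : FreeAlgebra S (Gen n) :=
  if h : 1 ≤ i ∧ i < n then FreeAlgebra.ι S (Gen.e i h) else 1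

/-- The defining relations of the affine Birman–Wenzl–Murakami algebra `Ŵ_{n,S}`. -/
inductive Rel (lam laminv del z : S) (q : ℕ → S) (n : ℕ) :
    FreeAlgebra S (Gen n) → FreeAlgebra S (Gen n) → Prop where
  -- (1) inverses
  | inv_right (i : ℕ) (h : 1 ≤ i ∧ i < n) :
      Rel lam laminv del z q n (FG S n i * FGi S n i) 1
  | inv_left (i : ℕ) (h : 1 ≤ i ∧ i < n) :
      Rel lam laminv del z q n (FGi S n i * FG S n i) 1
  | xinv_right : Rel lam laminv del z q n (FX S n * FXi S n) 1
  | xinv_left : Rel lam laminv del z q n (FXi S n * FX S n) 1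
  -- (2) idempotent relation
  | idem (i : ℕ) (h : 1 ≤ i ∧ i < n) :
      Rel lam laminv del z q n (FE S n i * FE S n i) (del • FE S n i)
  -- (3) affine braid relations
  | braid (i : ℕ) (h : 1 ≤ i ∧ i + 1 < n) :
      Rel lam laminv del z q n (FG S n i * FG S n (i + 1) * FG S n i)
        (FG S n (i + 1) * FG S n i * FG S n (i + 1))
  | comm_gg (i j : ℕ) (h : 1 ≤ i ∧ 1 ≤ j ∧ i < n ∧ j < n ∧ (i + 2 ≤ j ∨ j + 2 ≤ i)) :
      Rel lam laminv del z q n (FG S n i * FG S n j) (FG S n j * FG S n i)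
  | xbraid (h : 1 < n) :
      Rel lam laminv del z q n (FX S n * FG S n 1 * FX S n * FG S n 1)
        (FG S n 1 * FX S n * FG S n 1 * FX S n)
  | comm_xg (j : ℕ) (h : 2 ≤ j ∧ j < n) :
      Rel lam laminv del z q n (FX S n * FG S n j) (FG S n j * FX S n)
  -- (4) commutation relations
  | comm_ge (i j : ℕ) (h : 1 ≤ i ∧ 1 ≤ j ∧ i < n ∧ j < n ∧ (i + 2 ≤ j ∨ j + 2 ≤ i)) :
      Rel lam laminv del z q n (FG S n i * FE S n j) (FE S n j * FG S n i)
  | comm_ee (i j : ℕ) (h : 1 ≤ i ∧ 1 ≤ j ∧ i < n ∧ j < n ∧ (i + 2 ≤ j ∨ j + 2 ≤ i)) :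
      Rel lam laminv del z q n (FE S n i * FE S n j) (FE S n j * FE S n i)
  | comm_xe (j : ℕ) (h : 2 ≤ j ∧ j < n) :
      Rel lam laminv del z q n (FX S n * FE S n j) (FE S n j * FX S n)
  -- (5) affine tangle relations
  | tangle_eee_up (i : ℕ) (h : 1 ≤ i ∧ i + 1 < n) :
      Rel lam laminv del z q n (FE S n i * FE S n (i + 1) * FE S n i) (FE S n i)
  | tangle_eee_down (i : ℕ) (h : 1 ≤ i ∧ i + 1 < n) :
      Rel lam laminv del z q n (FE S n (i + 1) * FE S n i * FE S n (i + 1)) (FE S n (i + 1))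
  | tangle_gge_up (i : ℕ) (h : 1 ≤ i ∧ i + 1 < n) :
      Rel lam laminv del z q n (FG S n i * FG S n (i + 1) * FE S n i)
        (FE S n (i + 1) * FE S n i)
  | tangle_gge_down (i : ℕ) (h : 1 ≤ i ∧ i + 1 < n) :
      Rel lam laminv del z q n (FG S n (i + 1) * FG S n i * FE S n (i + 1))
        (FE S n i * FE S n (i + 1))
  | tangle_egg_up (i : ℕ) (h : 1 ≤ i ∧ i + 1 < n) :
      Rel lam laminv del z q n (FE S n i * FG S n (i + 1) * FG S n i)
        (FE S n i * FE S n (i + 1))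
  | tangle_egg_down (i : ℕ) (h : 1 ≤ i ∧ i + 1 < n) :
      Rel lam laminv del z q n (FE S n (i + 1) * FG S n i * FG S n (i + 1))
        (FE S n (i + 1) * FE S n i)
  | tangle_q (r : ℕ) (hr : 1 ≤ r) (h : 1 < n) :
      Rel lam laminv del z q n (FE S n 1 * FX S n ^ r * FE S n 1) (q r • FE S n 1)
  -- (6) Kauffman skein relation
  | skein (i : ℕ) (h : 1 ≤ i ∧ i < n) :
      Rel lam laminv del z q n (FG S n i - FGi S n i) (z • (FE S n i - 1))
  -- (7) untwisting relations
  | untwist_ge (i : ℕ) (h : 1 ≤ i ∧ i < n) :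
      Rel lam laminv del z q n (FG S n i * FE S n i) (laminv • FE S n i)
  | untwist_eg (i : ℕ) (h : 1 ≤ i ∧ i < n) :
      Rel lam laminv del z q n (FE S n i * FG S n i) (laminv • FE S n i)
  | untwist_ege_up (i : ℕ) (h : 1 ≤ i ∧ i + 1 < n) :
      Rel lam laminv del z q n (FE S n i * FG S n (i + 1) * FE S n i) (lam • FE S n i)
  | untwist_ege_down (i : ℕ) (h : 1 ≤ i ∧ i + 1 < n) :
      Rel lam laminv del z q n (FE S n (i + 1) * FG S n i * FE S n (i + 1))
        (lam • FE S n (i + 1))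
  -- (8) unwrapping relations
  | unwrap_left (h : 1 < n) :
      Rel lam laminv del z q n (FE S n 1 * FX S n * FG S n 1 * FX S n) (laminv • FE S n 1)
  | unwrap_right (h : 1 < n) :
      Rel lam laminv del z q n (FX S n * FG S n 1 * FX S n * FE S n 1) (laminv • FE S n 1)

/-- The affine Birman–Wenzl–Murakami algebra `Ŵ_{n,S}`, presented by
generators and relations. -/
abbrev Alg (lam laminv del z : S) (q : ℕ → S) (n : ℕ) : Type _ :=
  RingQuot (Rel S lam laminv del z q n)

variable (lam laminv del z : S) (q : ℕ → S) (n : ℕ)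

/-- The generator `x₁` of `Ŵ_{n,S}`. -/
noncomputable def ax : Alg S lam laminv del z q n :=
  RingQuot.mkAlgHom S (Rel S lam laminv del z q n) (FX S n)

/-- The generator `x₁⁻¹` of `Ŵ_{n,S}`. -/
noncomputable def axi : Alg S lam laminv del z q n :=
  RingQuot.mkAlgHom S (Rel S lam laminv del z q n) (FXi S n)

/-- The generator `g i` of `Ŵ_{n,S}`. -/
noncomputable def ag (i : ℕ) : Alg S lam laminv del z q n :=
  RingQuot.mkAlgHom S (Rel S lam laminv del z q n) (FG S n i)

/-- The generator `g i⁻¹` of `Ŵ_{n,S}`. -/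
noncomputable def agi (i : ℕ) : Alg S lam laminv del z q n :=
  RingQuot.mkAlgHom S (Rel S lam laminv del z q n) (FGi S n i)

/-- The generator `e i` of `Ŵ_{n,S}`. -/
noncomputable def ae (i : ℕ) : Alg S lam laminv del z q n :=
  RingQuot.mkAlgHom S (Rel S lam laminv del z q n) (FE S n i)

/-- The descending product `g_k ⋯ g_2 g_1`. -/
noncomputable def gdesc : ℕ → Alg S lam laminv del z q n
  | 0 => 1
  | k + 1 => ag S lam laminv del z q n (k + 1) * gdesc k

/-- The ascending product `g_1 g_2 ⋯ g_k`. -/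
noncomputable def gasc : ℕ → Alg S lam laminv del z q n
  | 0 => 1
  | k + 1 => gasc k * ag S lam laminv del z q n (k + 1)

/-- The descending product `g_k⁻¹ ⋯ g_2⁻¹ g_1⁻¹`. -/
noncomputable def gidesc : ℕ → Alg S lam laminv del z q n
  | 0 => 1
  | k + 1 => agi S lam laminv del z q n (k + 1) * gidesc k

/-- The ascending product `g_1⁻¹ g_2⁻¹ ⋯ g_k⁻¹`. -/
noncomputable def giasc : ℕ → Alg S lam laminv del z q n
  | 0 => 1
  | k + 1 => giasc k * agi S lam laminv del z q n (k + 1)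

/-- The element `x_r = (g_{r-1} ⋯ g_1) x_1 (g_1 ⋯ g_{r-1})` (this gives `x_1` for `r = 1`). -/
noncomputable def xvar (r : ℕ) : Alg S lam laminv del z q n :=
  gdesc S lam laminv del z q n (r - 1) * ax S lam laminv del z q n *
    gasc S lam laminv del z q n (r - 1)

/-- The element `x_r⁻¹ = (g_{r-1}⁻¹ ⋯ g_1⁻¹) x_1⁻¹ (g_1⁻¹ ⋯ g_{r-1}⁻¹)`. -/
noncomputable def xvarInv (r : ℕ) : Alg S lam laminv del z q n :=
  gidesc S lam laminv del z q n (r - 1) * axi S lam laminv del z q n *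
    giasc S lam laminv del z q n (r - 1)

/-- The integer power `x_r^m`. -/
noncomputable def xzpow (r : ℕ) (m : ℤ) : Alg S lam laminv del z q n :=
  if 0 ≤ m then xvar S lam laminv del z q n r ^ m.toNat
  else xvarInv S lam laminv del z q n r ^ (-m).toNat

end ABMW

namespace ABMW

section Bispan
variable {S A : Type*} [CommRing S] [Ring A] [Algebra S A]

/-- The `D`-sub-bimodule spanned by a set `T`. -/
def bispan (D : Subalgebra S A) (T : Set A) : Submodule S A :=
  Submodule.span S {t : A | ∃ a ∈ D, ∃ b ∈ D, ∃ χ ∈ T, t = a * χ * b}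

variable {D : Subalgebra S A} {T : Set A}

theorem mul_mul_mem_bispan {a b t : A} (ha : a ∈ D) (ht : t ∈ T) (hb : b ∈ D) :
    a * t * b ∈ bispan D T :=
  Submodule.subset_span ⟨a, ha, b, hb, t, ht, rfl⟩

theorem mem_bispan {t : A} (ht : t ∈ T) : t ∈ bispan D T := by
  simpa using mul_mul_mem_bispan (one_mem D) ht (one_mem D)

/-- A linear map sends `bispan D T` into `N` if it does so on products `a * t * b`. -/
theorem map_mem_of_mem_bispan {N : Submodule S A} (φ : A →ₗ[S] A)
    (h : ∀ a ∈ D, ∀ b ∈ D, ∀ t ∈ T, φ (a * t * b) ∈ N) {m : A} (hm : m ∈ bispan D T) :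
    φ m ∈ N := by
  have : bispan D T ≤ N.comap φ := by
    refine Submodule.span_le.2 ?_
    rintro _ ⟨a, ha, b, hb, t, ht, rfl⟩
    exact h a ha b hb t ht
  exact this hm

theorem mul_mem_bispan_left {d m : A} (hd : d ∈ D) (hm : m ∈ bispan D T) :
    d * m ∈ bispan D T := by
  refine map_mem_of_mem_bispan (LinearMap.mulLeft S d) (fun a ha b hb t ht ↦ ?_) hm
  simpa [mul_assoc] using mul_mul_mem_bispan (mul_mem hd ha) ht hb

theorem mul_mem_bispan_right {d m : A} (hd : d ∈ D) (hm : m ∈ bispan D T) :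
    m * d ∈ bispan D T := by
  refine map_mem_of_mem_bispan (LinearMap.mulRight S d) (fun a ha b hb t ht ↦ ?_) hm
  simpa [mul_assoc] using mul_mul_mem_bispan ha ht (mul_mem hb hd)

theorem bispan_mono {D' : Subalgebra S A} {T' : Set A} (hD : D ≤ D') (hT : T ⊆ T') :
    bispan D T ≤ bispan D' T' := by
  refine Submodule.span_mono ?_
  rintro _ ⟨a, ha, b, hb, t, ht, rfl⟩
  exact ⟨a, hD ha, b, hD hb, t, hT ht, rfl⟩

theorem zpow_mem_subalgebra {u : Aˣ} (h : (u : A) ∈ D) (h' : ((u⁻¹ : Aˣ) : A) ∈ D) (r : ℤ) :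
    ((u ^ r : Aˣ) : A) ∈ D := by
  cases r with
  | ofNat m => simpa using pow_mem h m
  | negSucc m =>
    rw [zpow_negSucc, ← inv_pow]
    simpa using pow_mem h' (m + 1)

end Bispan

section Twist
variable {S A : Type*} [CommRing S] [Ring A] [Algebra S A] {e : A} {V W : Aˣ} {a b : S}

theorem exists_mul_zpow (hc : Commute V W) (h : e * (V : A) = a • (e * (W : A)))
    (h' : e * ((V⁻¹ : Aˣ) : A) = b • (e * (W⁻¹ : Aˣ))) (r : ℤ) :
    ∃ u : S, e * (V ^ r : Aˣ) = u • (e * (W ^ r : Aˣ)) := by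
  induction r with
  | zero => exact ⟨1, by simp⟩
  | succ i ih =>
    obtain ⟨u, hu⟩ := ih
    refine ⟨u * a, ?_⟩
    have hVW : W ^ (i : ℤ) * V = V * W ^ (i : ℤ) := (hc.symm.zpow_left i).eq
    rw [zpow_add_one, Units.val_mul, ← mul_assoc, hu, smul_mul_assoc, mul_assoc, ← Units.val_mul,
      hVW, Units.val_mul, ← mul_assoc, h, add_comm, zpow_one_add, Units.val_mul, smul_mul_assoc,
        smul_smul, mul_assoc]
  | pred i ih =>
    obtain ⟨u, hu⟩ := ih
    refine ⟨u * b, ?_⟩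
    have hVW : W ^ (-i : ℤ) * V⁻¹ = V⁻¹ * W ^ (-i : ℤ) := (hc.inv_left.symm.zpow_left _).eq
    have hW : W ^ (-i - 1 : ℤ) = W⁻¹ * W ^ (-i : ℤ) := by
      rw [sub_eq_add_neg, add_comm, zpow_add, zpow_neg_one]
    rw [zpow_sub_one, Units.val_mul, ← mul_assoc, hu, smul_mul_assoc, mul_assoc, ← Units.val_mul,
      hVW, Units.val_mul, ← mul_assoc, h', hW, Units.val_mul, smul_mul_assoc, smul_smul, mul_assoc]

theorem exists_zpow_mul (hc : Commute V W) (h : (V : A) * e = a • ((W : A) * e))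
    (h' : ((V⁻¹ : Aˣ) : A) * e = b • ((W⁻¹ : Aˣ) * e)) (r : ℤ) :
    ∃ u : S, (V ^ r : Aˣ) * e = u • ((W ^ r : Aˣ) * e) := by
  induction r with
  | zero => exact ⟨1, by simp⟩
  | succ i ih =>
    obtain ⟨u, hu⟩ := ih
    refine ⟨u * a, ?_⟩
    have hVW : V * W ^ (i : ℤ) = W ^ (i : ℤ) * V := (hc.zpow_right i).eq
    rw [add_comm, zpow_one_add, Units.val_mul, mul_assoc, hu, mul_smul_comm, ← mul_assoc,
      ← Units.val_mul, hVW, Units.val_mul, mul_assoc, h, add_comm, zpow_add_one, Units.val_mul,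
      mul_smul_comm, smul_smul, mul_assoc]
  | pred i ih =>
    obtain ⟨u, hu⟩ := ih
    refine ⟨u * b, ?_⟩
    have hVW : V⁻¹ * W ^ (-i : ℤ) = W ^ (-i : ℤ) * V⁻¹ := (hc.inv_left.zpow_right _).eq
    have hV : V ^ (-i - 1 : ℤ) = V⁻¹ * V ^ (-i : ℤ) := by
      rw [sub_eq_add_neg, add_comm, zpow_add, zpow_neg_one]
    rw [hV, Units.val_mul, mul_assoc, hu, mul_smul_comm, ← mul_assoc,
      ← Units.val_mul, hVW, Units.val_mul, mul_assoc, h', zpow_sub_one, Units.val_mul,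
      mul_smul_comm, smul_smul, mul_assoc]

end Twist

section Level
variable {S A : Type*} [CommRing S] [Ring A] [Algebra S A]

/-- The relations between consecutive subalgebras `C ≤ D`, generated by the first strands,
and the elements `Y = x_k`, `g = g_k`, `e = e_k`. -/
structure Level (lam laminv del z : S) (C D : Subalgebra S A) (Y g : Aˣ) (e : A) : Prop where
  lam_mul : lam * laminv = 1
  scalar_skein : laminv - lam = z * (del - 1)
  le : C ≤ D
  Y_mem : (Y : A) ∈ D
  Y_inv_mem : ((Y⁻¹ : Aˣ) : A) ∈ D
  comm_Y : ∀ c ∈ C, c * Y = Y * c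
  comm_g : ∀ c ∈ C, c * g = g * c
  comm_e : ∀ c ∈ C, c * e = e * c
  comm_X : ∀ d ∈ D, d * (g * Y * g : Aˣ) = (g * Y * g : Aˣ) * d
  idem : e * e = del • e
  skein : (g : A) - (g⁻¹ : Aˣ) = z • (e - 1)
  ge : (g : A) * e = laminv • e
  eg : e * (g : A) = laminv • e
  unwrap_left : e * (Y * g * Y : Aˣ) = laminv • e
  unwrap_right : (Y * g * Y : Aˣ) * e = laminv • e

namespace Level
variable {lam laminv del z : S} {C D : Subalgebra S A} {Y g : Aˣ} {e : A}
  (L : Level lam laminv del z C D Y g e)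
include L

theorem g_inv : ((g⁻¹ : Aˣ) : A) = g - z • e + z • (1 : A) := by
  have := L.skein
  rw [smul_sub] at this
  rw [← sub_eq_zero] at this ⊢
  rw [← neg_eq_zero, ← this]; abel

theorem g_sq : (g : A) * g = 1 + (z * laminv) • e - z • (g : A) := by
  have h : (g : A) * (g⁻¹ : Aˣ) = 1 := by simp
  rw [L.g_inv] at h
  simp only [mul_add, mul_sub, mul_smul_comm, L.ge, mul_one] at h
  rw [← h, mul_smul]; abel

theorem commute_Y_X : Commute (Y : A) (g * Y * g : Aˣ) := L.comm_X _ L.Y_mem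

theorem commute_X_Y_units : Commute (g * Y * g) Y := by
  exact (Units.ext L.commute_Y_X.eq).symm

theorem commute_X_zpow {d : A} (hd : d ∈ D) (r : ℤ) :
    d * ((g * Y * g) ^ r : Aˣ) = ((g * Y * g) ^ r : Aˣ) * d := by
  have h : Commute d ((g * Y * g : Aˣ) : A) := L.comm_X d hd
  exact h.units_zpow_right r

theorem e_X : e * (g * Y * g : Aˣ) = (laminv * laminv) • (e * (Y⁻¹ : Aˣ)) := by
  have h : ((g * Y * g : Aˣ) : A) = g * (Y * g * Y : Aˣ) * (Y⁻¹ : Aˣ) := by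
    simp [mul_assoc]
  rw [h, ← mul_assoc, ← mul_assoc, L.eg, smul_mul_assoc, L.unwrap_left]
  simp [mul_smul]

theorem X_e : (g * Y * g : Aˣ) * e = (laminv * laminv) • ((Y⁻¹ : Aˣ) * e) := by
  have h : ((g * Y * g : Aˣ) : A) = (Y⁻¹ : Aˣ) * (Y * g * Y : Aˣ) * g := by
    simp [mul_assoc]
  rw [h, mul_assoc, L.ge, mul_smul_comm, mul_assoc, L.unwrap_right]
  simp [mul_smul]

theorem smul_e_X : e * (g * Y * g : Aˣ) * (Y : A) = (laminv * laminv) • e := by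
  rw [L.e_X]; simp [mul_assoc]

theorem smul_X_e : (Y : A) * ((g * Y * g : Aˣ) * e) = (laminv * laminv) • e := by
  rw [L.X_e]; simp

theorem lam_sq : (lam * lam) * (laminv * laminv) = 1 := by
  rw [mul_mul_mul_comm, L.lam_mul, one_mul]

theorem e_X_inv : e * ((g * Y * g)⁻¹ : Aˣ) = (lam * lam) • (e * (Y : A)) := by
  have h : ((lam * lam) * (laminv * laminv)) • e =
    (lam * lam) • (e * (g * Y * g : Aˣ) * (Y : A)) := by
    rw [L.smul_e_X, smul_smul]
  rw [L.lam_sq, one_smul, mul_assoc, ← L.commute_Y_X.eq] at h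
  conv_lhs => rw [h]
  rw [smul_mul_assoc, ← mul_assoc, Units.mul_inv_cancel_right]

theorem X_inv_e : ((g * Y * g)⁻¹ : Aˣ) * e = (lam * lam) • ((Y : A) * e) := by
  have h : ((lam * lam) * (laminv * laminv)) • e =
    (lam * lam) • ((Y : A) * ((g * Y * g : Aˣ) * e)) := by
    rw [L.smul_X_e, smul_smul]
  rw [L.lam_sq, one_smul, ← mul_assoc, L.commute_Y_X.eq, mul_assoc] at h
  conv_lhs => rw [h]
  rw [mul_smul_comm, Units.inv_mul_cancel_left]

theorem e_Y_inv : e * ((Y⁻¹ : Aˣ) : A) = (lam * lam) • (e * (g * Y * g : Aˣ)) := by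
  rw [L.e_X, smul_smul, L.lam_sq, one_smul]

theorem e_Y : e * (Y : A) = (laminv * laminv) • (e * ((g * Y * g)⁻¹ : Aˣ)) := by
  rw [L.e_X_inv, smul_smul, mul_comm, L.lam_sq, one_smul]

theorem e_X_zpow (r : ℤ) :
    ∃ u : S, e * ((g * Y * g) ^ r : Aˣ) = u • (e * (Y ^ (-r) : Aˣ)) := by
  simpa using exists_mul_zpow (W := Y⁻¹) L.commute_X_Y_units.inv_right L.e_X
    (by simpa using L.e_X_inv) r

theorem X_zpow_e (r : ℤ) :
    ∃ u : S, ((g * Y * g) ^ r : Aˣ) * e = u • ((Y ^ (-r) : Aˣ) * e) := by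
  simpa using exists_zpow_mul (W := Y⁻¹) L.commute_X_Y_units.inv_right L.X_e
    (by simpa using L.X_inv_e) r

theorem e_Y_zpow (r : ℤ) :
    ∃ u : S, e * (Y ^ r : Aˣ) = u • (e * ((g * Y * g) ^ (-r) : Aˣ)) := by
  rw [← inv_zpow']
  exact exists_mul_zpow L.commute_X_Y_units.symm.inv_right L.e_Y
    (by rw [inv_inv, L.e_Y_inv]) r

theorem Y_zpow_e (r : ℤ) :
    ∃ u : S, (Y ^ r : Aˣ) * e = u • (((g * Y * g) ^ (-r) : Aˣ) * e) := by
  have h : (Y : A) * e = (laminv * laminv) • (((g * Y * g)⁻¹ : Aˣ) * e) := by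
    rw [L.X_inv_e, smul_smul, mul_comm, L.lam_sq, one_smul]
  have h' : ((Y⁻¹ : Aˣ) : A) * e = (lam * lam) • ((g * Y * g : Aˣ) * e) := by
    rw [L.X_e, smul_smul, L.lam_sq, one_smul]
  rw [← inv_zpow']
  exact exists_zpow_mul L.commute_X_Y_units.symm.inv_right h (by rw [inv_inv, h']) r

end Level
end Level

section Level
variable {S A : Type*} [CommRing S] [Ring A] [Algebra S A]

/-- The spanning elements `e_k`, `g_k` and `x_{k+1}^r`, where `Y = x_k`, `g = g_k`, `e = e_k`. -/
def chiSet (Y g : Aˣ) (e : A) : Set A :=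
  {e, (g : A)} ∪ Set.range fun r : ℤ ↦ (((g * Y * g) ^ r : Aˣ) : A)

namespace Level
variable {lam laminv del z : S} {C D : Subalgebra S A} {Y g : Aˣ} {e : A}

theorem e_mem : e ∈ bispan D (chiSet Y g e) := mem_bispan (by simp [chiSet])

theorem g_mem : (g : A) ∈ bispan D (chiSet Y g e) := mem_bispan (by simp [chiSet])

theorem X_zpow_mem (r : ℤ) : (((g * Y * g) ^ r : Aˣ) : A) ∈ bispan D (chiSet Y g e) :=
  mem_bispan (Or.inr ⟨r, rfl⟩)

theorem one_mem_bispan : (1 : A) ∈ bispan D (chiSet Y g e) := by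
  simpa using X_zpow_mem (D := D) (Y := Y) (g := g) (e := e) 0

theorem ideal_le : bispan D {e} ≤ bispan D (chiSet Y g e) :=
  bispan_mono le_rfl (by simp [chiSet])

variable (L : Level lam laminv del z C D Y g e)
include L

theorem Y_zpow_mem (r : ℤ) : ((Y ^ r : Aˣ) : A) ∈ D :=
  zpow_mem_subalgebra L.Y_mem L.Y_inv_mem r

theorem commute_X_inv {d : A} (hd : d ∈ D) :
    d * ((g * Y * g)⁻¹ : Aˣ) = ((g * Y * g)⁻¹ : Aˣ) * d := by
  simpa only [zpow_neg_one] using L.commute_X_zpow hd (-1)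

theorem mul_X_mem_ideal {m : A} (hm : m ∈ bispan D {e}) :
    m * (g * Y * g : Aˣ) ∈ bispan D {e} := by
  refine map_mem_of_mem_bispan (LinearMap.mulRight S _) (fun a ha b hb t ht ↦ ?_) hm
  obtain rfl : t = e := ht
  rw [LinearMap.mulRight_apply, mul_assoc, L.comm_X b hb, ← mul_assoc, mul_assoc a, L.e_X,
    mul_smul_comm, smul_mul_assoc, ← mul_assoc, mul_assoc]
  exact Submodule.smul_mem _ _ (mul_mul_mem_bispan ha rfl (mul_mem L.Y_inv_mem hb))

theorem mul_X_inv_mem_ideal {m : A} (hm : m ∈ bispan D {e}) :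
    m * ((g * Y * g)⁻¹ : Aˣ) ∈ bispan D {e} := by
  refine map_mem_of_mem_bispan (LinearMap.mulRight S _) (fun a ha b hb t ht ↦ ?_) hm
  obtain rfl : t = e := ht
  rw [LinearMap.mulRight_apply, mul_assoc, L.commute_X_inv hb, ← mul_assoc, mul_assoc a, L.e_X_inv,
    mul_smul_comm, smul_mul_assoc, ← mul_assoc, mul_assoc]
  exact Submodule.smul_mem _ _ (mul_mul_mem_bispan ha rfl (mul_mem L.Y_mem hb))

theorem X_mul_mem_ideal {m : A} (hm : m ∈ bispan D {e}) :
    (g * Y * g : Aˣ) * m ∈ bispan D {e} := by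
  refine map_mem_of_mem_bispan (LinearMap.mulLeft S _) (fun a ha b hb t ht ↦ ?_) hm
  obtain rfl : t = e := ht
  rw [LinearMap.mulLeft_apply, ← mul_assoc, ← mul_assoc, ← L.comm_X a ha, mul_assoc a, L.X_e,
    mul_smul_comm, smul_mul_assoc, ← mul_assoc]
  exact Submodule.smul_mem _ _ (mul_mul_mem_bispan (mul_mem ha L.Y_inv_mem) rfl hb)

theorem X_inv_mul_mem_ideal {m : A} (hm : m ∈ bispan D {e}) :
    ((g * Y * g)⁻¹ : Aˣ) * m ∈ bispan D {e} := by
  refine map_mem_of_mem_bispan (LinearMap.mulLeft S _) (fun a ha b hb t ht ↦ ?_) hm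
  obtain rfl : t = e := ht
  rw [LinearMap.mulLeft_apply, ← mul_assoc, ← mul_assoc, ← L.commute_X_inv ha, mul_assoc a,
    L.X_inv_e, mul_smul_comm, smul_mul_assoc, ← mul_assoc]
  exact Submodule.smul_mem _ _ (mul_mul_mem_bispan (mul_mem ha L.Y_mem) rfl hb)

theorem Y_mul_g :
    (Y : A) * g = g * (g * Y * g : Aˣ) - z • (e * (g * Y * g : Aˣ)) + z • ((g * Y * g : Aˣ) : A) :=
      by
  have h : (Y : A) * g = (g⁻¹ : Aˣ) * (g * Y * g : Aˣ) := by simp [mul_assoc]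
  rw [h, L.g_inv]
  simp only [add_mul, sub_mul, smul_mul_assoc, one_mul]

theorem g_mul_Y :
    (g : A) * Y = (g * Y * g : Aˣ) * g - z • ((g * Y * g : Aˣ) * e) + z • ((g * Y * g : Aˣ) : A) :=
      by
  have h : (g : A) * Y = (g * Y * g : Aˣ) * (g⁻¹ : Aˣ) := by simp [mul_assoc]
  rw [h, L.g_inv]
  simp only [mul_add, mul_sub, mul_smul_comm, mul_one]

theorem Y_zpow_mul_g (r : ℤ) (w : A) :
    w * (Y ^ (r + 1) : Aˣ) * g = w * (Y ^ r : Aˣ) * g * (g * Y * g : Aˣ)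
      - z • (w * (Y ^ r : Aˣ) * e * (g * Y * g : Aˣ)) + z • (w * (Y ^ r : Aˣ) * (g * Y * g : Aˣ))
        := by
  rw [zpow_add_one, Units.val_mul, mul_assoc, mul_assoc, L.Y_mul_g]
  simp only [mul_add, mul_sub, mul_smul_comm, mul_assoc]

theorem g_mul_Y_zpow (r : ℤ) (w : A) :
    g * (Y ^ (r + 1) : Aˣ) * w = (g * Y * g : Aˣ) * (g * (Y ^ r : Aˣ) * w)
      - z • ((g * Y * g : Aˣ) * (e * (Y ^ r : Aˣ) * w))
      + z • ((g * Y * g : Aˣ) * ((Y ^ r : Aˣ) * w)) := by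
  rw [add_comm, zpow_one_add, Units.val_mul, ← mul_assoc, L.g_mul_Y]
  simp only [add_mul, sub_mul, smul_mul_assoc, mul_assoc]

theorem X_inv_g_mem : ((g * Y * g)⁻¹ : Aˣ) * (g : A) ∈ bispan D (chiSet Y g e) := by
  have h : ((g * Y * g)⁻¹ : Aˣ) * (g : A) = (g⁻¹ : Aˣ) * (Y⁻¹ : Aˣ) := by simp [mul_assoc]
  rw [h, L.g_inv]
  exact mul_mem_bispan_right L.Y_inv_mem (add_mem (sub_mem g_mem (Submodule.smul_mem _ _ e_mem))
    (Submodule.smul_mem _ _ one_mem_bispan))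

variable (hP : ∀ r : ℤ, e * (Y ^ r : Aˣ) * e ∈ bispan D {e})
include hP

theorem e_Y_zpow_g_mem (r : ℤ) : e * (Y ^ r : Aˣ) * g ∈ bispan D {e} := by
  have he : e ∈ bispan D {e} := mem_bispan rfl
  have hY (i : ℤ) : e * (Y ^ i : Aˣ) ∈ bispan D {e} := mul_mem_bispan_right (L.Y_zpow_mem i) he
  have key (i : ℤ) := L.Y_zpow_mul_g i e
  induction r with
  | zero => simpa [L.eg] using Submodule.smul_mem _ laminv he
  | succ i ih =>
    rw [key]
    exact add_mem (sub_mem (L.mul_X_mem_ideal ih)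
      (Submodule.smul_mem _ _ (L.mul_X_mem_ideal (hP _))))
      (Submodule.smul_mem _ _ (L.mul_X_mem_ideal (hY _)))
  | pred i ih =>
    have h := key (-i - 1)
    rw [sub_add_cancel] at h
    have h2 : e * (Y ^ (-i - 1 : ℤ) : Aˣ) * g * (g * Y * g : Aˣ) ∈ bispan D {e} := by
      rw [h, ← add_sub_right_comm] at ih
      have := sub_mem (add_mem ih (Submodule.smul_mem _ z (L.mul_X_mem_ideal (hP (-i - 1)))))
        (Submodule.smul_mem _ z (L.mul_X_mem_ideal (hY (-i - 1))))
      simpa using this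
    simpa only [Units.mul_inv_cancel_right] using L.mul_X_inv_mem_ideal h2

theorem g_Y_zpow_e_mem (r : ℤ) : g * (Y ^ r : Aˣ) * e ∈ bispan D {e} := by
  have he : e ∈ bispan D {e} := mem_bispan rfl
  have hY (i : ℤ) : (Y ^ i : Aˣ) * e ∈ bispan D {e} := mul_mem_bispan_left (L.Y_zpow_mem i) he
  have key (i : ℤ) := L.g_mul_Y_zpow i e
  induction r with
  | zero => simpa [L.ge] using Submodule.smul_mem _ laminv he
  | succ i ih =>
    rw [key]
    exact add_mem (sub_mem (L.X_mul_mem_ideal ih)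
      (Submodule.smul_mem _ _ (L.X_mul_mem_ideal (hP _))))
      (Submodule.smul_mem _ _ (L.X_mul_mem_ideal (hY _)))
  | pred i ih =>
    have h := key (-i - 1)
    rw [sub_add_cancel] at h
    have h2 : (g * Y * g : Aˣ) * (g * (Y ^ (-i - 1 : ℤ) : Aˣ) * e) ∈ bispan D {e} := by
      rw [h, ← add_sub_right_comm] at ih
      have := sub_mem (add_mem ih (Submodule.smul_mem _ z (L.X_mul_mem_ideal (hP (-i - 1)))))
        (Submodule.smul_mem _ z (L.X_mul_mem_ideal (hY (-i - 1))))
      simpa using this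
    simpa only [Units.inv_mul_cancel_left] using L.X_inv_mul_mem_ideal h2

theorem X_g_mem : ((g * Y * g : Aˣ) : A) * g ∈ bispan D (chiSet Y g e) := by
  have h : ((g * Y * g : Aˣ) : A) * g =
    g * Y + (z * laminv) • (g * Y * e) - z • ((g * Y * g : Aˣ) : A) := by
    rw [Units.val_mul, mul_assoc, L.g_sq]
    simp only [mul_add, mul_sub, mul_smul_comm, mul_one, Units.val_mul]
  rw [h]
  refine sub_mem (add_mem (mul_mem_bispan_right L.Y_mem g_mem)
    (Submodule.smul_mem _ _ (ideal_le ?_)))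
    (Submodule.smul_mem _ _ (by simpa using X_zpow_mem (D := D) (Y := Y) (g := g) (e := e) 1))
  simpa using L.g_Y_zpow_e_mem hP 1

theorem X_mul_mem {m : A} (hm : m ∈ bispan D (chiSet Y g e)) :
    (g * Y * g : Aˣ) * m ∈ bispan D (chiSet Y g e) := by
  refine map_mem_of_mem_bispan (LinearMap.mulLeft S _) (fun a ha b hb t ht ↦ ?_) hm
  rw [LinearMap.mulLeft_apply, ← mul_assoc, ← mul_assoc, ← L.comm_X a ha, mul_assoc a]
  refine mul_mem_bispan_right hb (mul_mem_bispan_left ha ?_)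
  rcases ht with (rfl | rfl) | ⟨r, rfl⟩
  · exact ideal_le (L.X_mul_mem_ideal (mem_bispan rfl))
  · exact L.X_g_mem hP
  · simpa only [zpow_one_add, Units.val_mul] using
      X_zpow_mem (D := D) (Y := Y) (g := g) (e := e) (1 + r)

theorem X_inv_mul_mem {m : A} (hm : m ∈ bispan D (chiSet Y g e)) :
    ((g * Y * g)⁻¹ : Aˣ) * m ∈ bispan D (chiSet Y g e) := by
  refine map_mem_of_mem_bispan (LinearMap.mulLeft S _) (fun a ha b hb t ht ↦ ?_) hm
  rw [LinearMap.mulLeft_apply, ← mul_assoc, ← mul_assoc, ← L.commute_X_inv ha, mul_assoc a]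
  refine mul_mem_bispan_right hb (mul_mem_bispan_left ha ?_)
  rcases ht with (rfl | rfl) | ⟨r, rfl⟩
  · exact ideal_le (L.X_inv_mul_mem_ideal (mem_bispan rfl))
  · exact L.X_inv_g_mem
  · simpa only [zpow_add, zpow_neg_one, Units.val_mul] using
      X_zpow_mem (D := D) (Y := Y) (g := g) (e := e) (-1 + r)

theorem X_zpow_mul_mem (r : ℤ) {m : A} (hm : m ∈ bispan D (chiSet Y g e)) :
    ((g * Y * g) ^ r : Aˣ) * m ∈ bispan D (chiSet Y g e) := by
  induction r with
  | zero => simpa using hm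
  | succ i ih =>
    rw [add_comm, zpow_one_add, Units.val_mul, mul_assoc]
    exact L.X_mul_mem hP ih
  | pred i ih =>
    rw [sub_eq_add_neg, add_comm, zpow_add, zpow_neg_one, Units.val_mul, mul_assoc]
    exact L.X_inv_mul_mem hP ih

theorem g_Y_zpow_g_mem (r : ℤ) : (g : A) * (Y ^ r : Aˣ) * g ∈ bispan D (chiSet Y g e) := by
  have hY (i : ℤ) : (Y ^ i : Aˣ) * (g : A) ∈ bispan D (chiSet Y g e) :=
    mul_mem_bispan_left (L.Y_zpow_mem i) g_mem
  have hE (i : ℤ) := ideal_le (g := g) (Y := Y) (L.e_Y_zpow_g_mem hP i)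
  have key (i : ℤ) := L.g_mul_Y_zpow i g
  induction r with
  | zero =>
    simp only [zpow_zero, Units.val_one, mul_one, L.g_sq]
    exact sub_mem (add_mem one_mem_bispan (Submodule.smul_mem _ _ e_mem))
      (Submodule.smul_mem _ _ g_mem)
  | succ i ih =>
    rw [key]
    exact add_mem (sub_mem (L.X_mul_mem hP ih) (Submodule.smul_mem _ _ (L.X_mul_mem hP (hE _))))
      (Submodule.smul_mem _ _ (L.X_mul_mem hP (hY _)))
  | pred i ih =>
    have h := key (-i - 1)
    rw [sub_add_cancel] at h
    have h2 : (g * Y * g : Aˣ) * ((g : A) * (Y ^ (-i - 1 : ℤ) : Aˣ) * g) ∈ bispan D (chiSet Y g e)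
      := by
      rw [h, ← add_sub_right_comm] at ih
      have := sub_mem (add_mem ih (Submodule.smul_mem _ z (L.X_mul_mem hP (hE (-i - 1)))))
        (Submodule.smul_mem _ z (L.X_mul_mem hP (hY (-i - 1))))
      simpa using this
    simpa only [Units.inv_mul_cancel_left] using L.X_inv_mul_mem hP h2

/-- Products of two spanning elements with a power of `Y` in between stay in the span. -/
theorem mul_Y_zpow_mul_mem (r : ℤ) {χ ξ : A} (hχ : χ ∈ ({e, (g : A)} : Set A))
    (hξ : ξ ∈ ({e, (g : A)} : Set A)) : χ * (Y ^ r : Aˣ) * ξ ∈ bispan D (chiSet Y g e) := by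
  rcases hχ with rfl | rfl <;> rcases hξ with rfl | rfl
  · exact ideal_le (hP r)
  · exact ideal_le (L.e_Y_zpow_g_mem hP r)
  · exact ideal_le (L.g_Y_zpow_e_mem hP r)
  · exact L.g_Y_zpow_g_mem hP r

theorem mul_mem_of_forall {T : Set A} (hT : (D.toSubmodule : Submodule S A) ≤ bispan C T)
    (hgood : ∀ t ∈ T, ∀ χ ∈ ({e, (g : A)} : Set A), ∀ ξ ∈ ({e, (g : A)} : Set A),
      χ * t * ξ ∈ bispan D (chiSet Y g e))
    {m ξ : A} (hξ : ξ ∈ ({e, (g : A)} : Set A)) (hm : m ∈ bispan D (chiSet Y g e)) :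
    m * ξ ∈ bispan D (chiSet Y g e) := by
  have hξM : ξ ∈ bispan D (chiSet Y g e) := mem_bispan (Or.inl hξ)
  have comm (η : A) (hη : η ∈ ({e, (g : A)} : Set A)) (c : A) (hc : c ∈ C) : c * η = η * c := by
    rcases hη with rfl | rfl
    exacts [L.comm_e c hc, L.comm_g c hc]
  refine map_mem_of_mem_bispan (LinearMap.mulRight S ξ) (fun a ha b hb χ hχ ↦ ?_) hm
  rw [LinearMap.mulRight_apply, mul_assoc, mul_assoc]
  refine mul_mem_bispan_left ha ?_
  rcases hχ with hχ | ⟨r, rfl⟩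
  · refine map_mem_of_mem_bispan ((LinearMap.mulLeft S χ).comp (LinearMap.mulRight S ξ))
      (fun c hc c' hc' t ht ↦ ?_) (hT hb)
    have : χ * (c * t * c' * ξ) = c * (χ * t * ξ) * c' := by
      rw [mul_assoc (c * t), comm ξ hξ c' hc']
      simp only [← mul_assoc]
      rw [comm χ hχ c hc]
    rw [LinearMap.comp_apply, LinearMap.mulRight_apply, LinearMap.mulLeft_apply, this]
    exact mul_mem_bispan_right (L.le hc') (mul_mem_bispan_left (L.le hc) (hgood t ht χ hχ ξ hξ))
  · rw [← mul_assoc, ← L.commute_X_zpow hb, mul_assoc]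
    exact mul_mem_bispan_left hb (L.X_zpow_mul_mem hP r hξM)

end Level
end Level

section Level
variable {S A : Type*} [CommRing S] [Ring A] [Algebra S A]

/-- The `S`-submodule `C * e`. -/
def corner (C : Subalgebra S A) (e : A) : Submodule S A :=
  C.toSubmodule.map (LinearMap.mulRight S e)

theorem mem_corner {C : Subalgebra S A} {e w : A} : w ∈ corner C e ↔ ∃ c ∈ C, c * e = w := by
  simp [corner]

theorem mul_mem_corner {C : Subalgebra S A} {e w c : A} (hc : c ∈ C) (hw : w ∈ corner C e) :
    c * w ∈ corner C e := by
  obtain ⟨d, hd, rfl⟩ := mem_corner.1 hw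
  exact mem_corner.2 ⟨c * d, mul_mem hc hd, mul_assoc _ _ _⟩

theorem self_mem_corner {C : Subalgebra S A} {e : A} : e ∈ corner C e :=
  mem_corner.2 ⟨1, one_mem C, one_mul e⟩

theorem mul_mem_corner_of_mul_mem {C : Subalgebra S A} {e w v : A} (hw : w ∈ corner C e)
    (hv : e * v ∈ corner C e) : w * v ∈ corner C e := by
  obtain ⟨d, hd, rfl⟩ := mem_corner.1 hw
  rw [mul_assoc]
  exact mul_mem_corner hd hv

theorem corner_le_bispan {C D : Subalgebra S A} (h : C ≤ D) (e : A) :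
    corner C e ≤ bispan D {e} := by
  intro w hw
  obtain ⟨d, hd, rfl⟩ := mem_corner.1 hw
  exact mul_mem_bispan_left (h hd) (mem_bispan rfl)

namespace Level
variable {lam laminv del z : S} {C D : Subalgebra S A} {Y g : Aˣ} {e : A}
  (L : Level lam laminv del z C D Y g e)
include L

theorem e_X_pow_e_mem (hpos : ∀ r : ℕ, e * (Y ^ (r : ℤ) : Aˣ) * e ∈ corner C e) (r : ℕ) :
    e * ((g * Y * g) ^ (r : ℤ) : Aˣ) * e ∈ corner C e := by
  induction r using Nat.strong_induction_on with
  | _ r ih =>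
  obtain _ | q := r
  · simpa using hpos 0
  have low (s : ℤ) (hs : -s ≤ q) : e * (Y ^ s : Aˣ) * e ∈ corner C e := by
    obtain ⟨k, rfl | rfl⟩ := s.eq_nat_or_neg
    · exact hpos k
    · obtain ⟨u, hu⟩ := L.e_Y_zpow (-k)
      rw [hu, neg_neg, smul_mul_assoc]
      exact Submodule.smul_mem _ _ (ih k (by omega))
  have claim (m : ℕ) : ∀ p : ℕ, m + p = q →
      e * (Y ^ (m + 1 : ℤ) : Aˣ) * g * ((g * Y * g) ^ (p : ℤ) : Aˣ) * e
        - e * Y * g * ((g * Y * g) ^ (q : ℤ) : Aˣ) * e ∈ corner C e := by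
    induction m with
    | zero =>
      intro p hp
      obtain rfl : p = q := by omega
      simp
    | succ m ihm =>
      intro p hp
      have h1 : e * (Y ^ (m + 1 : ℤ) : Aˣ) * e * (((g * Y * g) ^ (p + 1 : ℤ) : Aˣ) * e)
          ∈ corner C e := by
        refine mul_mem_corner_of_mul_mem (low _ (by omega)) ?_
        rw [← mul_assoc]
        exact_mod_cast ih (p + 1) (by omega)
      have h2 : e * (Y ^ (m + 1 : ℤ) : Aˣ) * (((g * Y * g) ^ (p + 1 : ℤ) : Aˣ) * e)
          ∈ corner C e := by
        obtain ⟨u, hu⟩ := L.X_zpow_e (p + 1)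
        rw [hu, mul_smul_comm, ← mul_assoc, mul_assoc e, ← Units.val_mul, ← zpow_add]
        exact Submodule.smul_mem _ _ (low _ (by omega))
      have h3 := ihm (p + 1) (by omega)
      have key := L.Y_zpow_mul_g (m + 1) e
      push_cast at h3 ⊢
      rw [key]
      have hX : ((g * Y * g) ^ (p + 1 : ℤ) : Aˣ) = (g * Y * g) * (g * Y * g) ^ (p : ℤ) := by
        rw [add_comm, zpow_one_add]
      rw [hX, Units.val_mul] at h1 h2 h3
      have := add_mem (sub_mem h3 (Submodule.smul_mem _ z h1)) (Submodule.smul_mem _ z h2)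
      convert this using 1
      simp only [add_mul, sub_mul, smul_mul_assoc, mul_assoc]
      abel
  have h1 := claim q 0 (by omega)
  have h2 : e * (Y ^ (q + 1 : ℤ) : Aˣ) * g * ((g * Y * g) ^ ((0 : ℕ) : ℤ) : Aˣ) * e ∈ corner C e :=
    by
    simp only [Nat.cast_zero, zpow_zero, Units.val_one, mul_one]
    rw [mul_assoc, L.ge, mul_smul_comm]
    exact Submodule.smul_mem _ _ (by exact_mod_cast hpos (q + 1))
  have h3 : e * Y * g * ((g * Y * g) ^ (q : ℤ) : Aˣ) * e ∈ corner C e := by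
    simpa using sub_mem h2 h1
  have h4 : e * Y * g * ((g * Y * g) ^ (q : ℤ) : Aˣ) * e
      = lam • (e * ((g * Y * g) ^ ((q + 1 : ℕ) : ℤ) : Aˣ) * e) := by
    have hX : ((g * Y * g) ^ ((q + 1 : ℕ) : ℤ) : Aˣ) = (g * Y * g) * (g * Y * g) ^ (q : ℤ) := by
      rw [← zpow_one_add]; push_cast; rw [add_comm]
    have hl : lam = laminv - z * del + z := by
      linear_combination - L.scalar_skein
    rw [hX, mul_assoc e, L.Y_mul_g, hl]
    simp only [mul_add, add_mul, mul_sub, sub_mul, add_smul, sub_smul, mul_smul, mul_smul_comm,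
      smul_mul_assoc, ← mul_assoc, L.eg, L.idem, Units.val_mul, smul_comm del laminv]
  rw [h4] at h3
  have := Submodule.smul_mem _ laminv h3
  rwa [smul_smul, mul_comm, L.lam_mul, one_smul] at this

theorem e_Y_zpow_e_mem (hpos : ∀ r : ℕ, e * (Y ^ (r : ℤ) : Aˣ) * e ∈ corner C e) (r : ℤ) :
    e * (Y ^ r : Aˣ) * e ∈ corner C e := by
  obtain ⟨k, rfl | rfl⟩ := r.eq_nat_or_neg
  · exact hpos k
  · obtain ⟨u, hu⟩ := L.e_Y_zpow (-k)
    rw [hu, neg_neg, smul_mul_assoc]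
    exact Submodule.smul_mem _ _ (L.e_X_pow_e_mem hpos k)

end Level

/-- The relations between `h = g_{k-1}`, `f = e_{k-1}` and `g = g_k`, `e = e_k`. -/
structure Tangle (lam : S) (h g : Aˣ) (f e : A) : Prop where
  efe : e * f * e = e
  ehe : e * (h : A) * e = lam • e
  ehg : e * (h : A) * g = e * f
  ghe : (g : A) * h * e = f * e
  hgf : (h : A) * g * f = e * f
  fgh : f * (g : A) * h = f * e
  braid : g * h * g = h * g * h

section Step
variable {lam laminv del z : S} {C' C D : Subalgebra S A} {Z h g : Aˣ} {f e : A}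
  (L' : Level lam laminv del z C' C Z h f) (L : Level lam laminv del z C D (h * Z * h) g e)
  (R : Tangle lam h g f e)

include L R in
theorem e_mul_mul_e_mem_corner {m : A} (hm : m ∈ bispan C {f}) : e * m * e ∈ corner C e := by
  refine map_mem_of_mem_bispan ((LinearMap.mulRight S e).comp (LinearMap.mulLeft S e))
    (fun a ha b hb t ht ↦ ?_) hm
  obtain rfl : t = f := ht
  refine mem_corner.2 ⟨a * b, mul_mem ha hb, ?_⟩
  calc a * b * e = a * (e * t * e) * b := by rw [R.efe, mul_assoc, mul_assoc, L.comm_e b hb]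
    _ = (a * e) * t * (e * b) := by simp only [mul_assoc]
    _ = e * (a * t * b) * e := by
      rw [L.comm_e a ha, ← L.comm_e b hb]; simp only [mul_assoc]

include L' in
theorem Y_pow_mul_mem {m : A} (hm : m ∈ bispan C {f}) (r : ℕ) :
    ((h * Z * h) ^ (r : ℤ) : Aˣ) * m ∈ bispan C {f} := by
  induction r with
  | zero => simpa using hm
  | succ i ih =>
    push_cast
    rw [add_comm, zpow_one_add, Units.val_mul, mul_assoc]
    exact L'.X_mul_mem_ideal ih

include L R in
theorem g_inv_h_e : (g⁻¹ : Aˣ) * (h * e) = f * e - (z * lam) • e + z • (h * e) := by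
  rw [L.g_inv]
  simp only [add_mul, sub_mul, smul_mul_assoc, one_mul, ← mul_assoc, R.ghe, R.ehe, mul_smul]

include R in
theorem e_h : e * (h : A) = e * f * (g⁻¹ : Aˣ) := by
  rw [← R.ehg, Units.mul_inv_cancel_right]

variable (hf : ∀ r : ℤ, f * (Z ^ r : Aˣ) * f ∈ bispan C {f})

include L R L' hf in
theorem e_f_Z_zpow_mem (hfD : f ∈ D) (k : ℕ)
    (hQ : ∀ j ≤ k, e * ((h * Z * h) ^ (j : ℤ) : Aˣ) * h * e ∈ corner C e) :
    ∀ a : ℤ, e * f * (Z ^ a : Aˣ) * (g⁻¹ : Aˣ) * ((g * (h * Z * h) * g) ^ (-k : ℤ) : Aˣ) * (h * e)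
      ∈ corner C e := by
  have hfh (a : ℤ) := L'.e_Y_zpow_g_mem hf a
  have hefe (a : ℤ) : e * f * (Z ^ a : Aˣ) * e = (Z ^ a : Aˣ) * e := by
    rw [mul_assoc _ _ e, L.comm_e _ (L'.Y_zpow_mem a), ← mul_assoc, R.efe]
  induction k with
  | zero =>
    intro a
    have := add_mem (sub_mem (e_mul_mul_e_mem_corner L R (hf a))
      (Submodule.smul_mem _ (z * lam) (mul_mem_corner (L'.Y_zpow_mem a) self_mem_corner)))
      (Submodule.smul_mem _ z (e_mul_mul_e_mem_corner L R (hfh a)))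
    convert this using 1
    simp only [Nat.cast_zero, neg_zero, zpow_zero, Units.val_one, mul_one]
    rw [mul_assoc, g_inv_h_e L R, ← hefe]
    simp only [mul_add, mul_sub, mul_smul_comm, mul_assoc]
  | succ k ih =>
    intro a
    have h1 := ih (fun j hj ↦ hQ j (by omega)) (a + 1)
    have h2 : e * f * (Z ^ a : Aˣ) * e * ((g * (h * Z * h) * g) ^ (-(k + 1) : ℤ) : Aˣ) * (h * e)
        ∈ corner C e := by
      obtain ⟨u, hu⟩ := L.e_X_zpow (-(k + 1))
      have assoc : ∀ w v x : A, w * e * v * x = w * (e * v * x) := fun w v x ↦ by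
        simp only [mul_assoc]
      rw [hefe, assoc, hu, smul_mul_assoc, mul_smul_comm, neg_neg, ← mul_assoc _ (h : A)]
      refine Submodule.smul_mem _ _ (mul_mem_corner (L'.Y_zpow_mem a) ?_)
      exact_mod_cast hQ (k + 1) le_rfl
    have h3 : e * f * (Z ^ a : Aˣ) * ((g * (h * Z * h) * g) ^ (-(k + 1) : ℤ) : Aˣ) * (h * e)
        ∈ corner C e := by
      obtain ⟨u, hu⟩ := L.e_X_zpow (-(k + 1))
      have hfZ : f * (Z ^ a : Aˣ) ∈ D := mul_mem hfD (L.le (L'.Y_zpow_mem a))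
      rw [mul_assoc e, mul_assoc e, L.commute_X_zpow hfZ, ← mul_assoc e, hu, neg_neg]
      simp only [smul_mul_assoc]
      refine Submodule.smul_mem _ _ ?_
      have := e_mul_mul_e_mem_corner L R (Y_pow_mul_mem L' (hfh a) (k + 1))
      simpa only [Nat.cast_add, Nat.cast_one, mul_assoc] using this
    have hXX : ((g * (h * Z * h) * g) ^ (-(k + 1) : ℤ) : Aˣ)
        = (g * (h * Z * h) * g)⁻¹ * (g * (h * Z * h) * g) ^ (-k : ℤ) := by
      rw [neg_add_rev, zpow_add, zpow_neg_one]
    have hgX : (g : A) * ((g * (h * Z * h) * g)⁻¹ : Aˣ)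
        = ((h * Z * h)⁻¹ : Aˣ) * (g⁻¹ : Aˣ) := by
      rw [← Units.val_mul, ← Units.val_mul]
      congr 1
      group
    have hfY : f * (Z ^ a : Aˣ) * ((h * Z * h)⁻¹ : Aˣ) =
      (lam * lam) • (f * (Z ^ (a + 1) : Aˣ)) := by
      rw [mul_assoc, L'.commute_X_inv (L'.Y_zpow_mem a), ← mul_assoc, L'.e_X_inv, smul_mul_assoc,
        mul_assoc, ← Units.val_mul, add_comm, zpow_one_add]
    have := add_mem (sub_mem (Submodule.smul_mem _ (lam * lam) h1) (Submodule.smul_mem _ z h2))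
      (Submodule.smul_mem _ z h3)
    convert this using 1
    push_cast
    have e1 : e * f * (Z ^ a : Aˣ) * g * ((g * (h * Z * h) * g) ^ (-(k + 1) : ℤ) : Aˣ) * (h * e)
        = (lam * lam) • (e * f * (Z ^ (a + 1) : Aˣ) * (g⁻¹ : Aˣ) *
          ((g * (h * Z * h) * g) ^ (-k : ℤ) : Aˣ) * (h * e)) := by
      have assoc : ∀ w v x y y' : A, e * f * w * v * (x * y) * y' =
        e * (f * w) * (v * x) * y * y' :=
        fun w v x y y' ↦ by simp only [mul_assoc]
      rw [hXX, Units.val_mul, assoc, hgX, mul_assoc e, ← mul_assoc (f * _), hfY]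
      simp only [mul_smul_comm, smul_mul_assoc, mul_assoc]
    rw [← e1, L.g_inv]
    simp only [mul_add, mul_sub, add_mul, sub_mul, mul_smul_comm, smul_mul_assoc, mul_one]

include L R L' hf in
theorem e_Y_pow_e_mem (hfD : f ∈ D) (hhD : (h : A) ∈ D) (r : ℕ) :
    ∀ j ≤ r, e * ((h * Z * h) ^ (j : ℤ) : Aˣ) * e ∈ corner C e ∧
      e * ((h * Z * h) ^ (j : ℤ) : Aˣ) * h * e ∈ corner C e := by
  induction r with
  | zero =>
    intro j hj
    obtain rfl : j = 0 := by omega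
    simp only [Nat.cast_zero, zpow_zero, Units.val_one, mul_one, L.idem, R.ehe]
    exact ⟨Submodule.smul_mem _ _ self_mem_corner, Submodule.smul_mem _ _ self_mem_corner⟩
  | succ r ih =>
    intro j hj
    obtain hj | rfl := Nat.le_succ_iff.1 hj
    · exact ih j hj
    have hP : e * ((h * Z * h) ^ ((r + 1 : ℕ) : ℤ) : Aˣ) * e ∈ corner C e := by
      have h1 := e_f_Z_zpow_mem L' L R hf hfD r (fun j hj ↦ (ih j hj).2) 1
      obtain ⟨u, hu⟩ := L.Y_zpow_e r
      have hZ : (Z : A) * (g⁻¹ : Aˣ) = (g⁻¹ : Aˣ) * Z :=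
        (Commute.units_inv_right (show Commute (Z : A) g from L.comm_g _ L'.Y_mem)).eq
      have : e * ((h * Z * h) ^ ((r + 1 : ℕ) : ℤ) : Aˣ) * e
          = u • (e * f * (Z ^ (1 : ℤ) : Aˣ) * (g⁻¹ : Aˣ) *
            ((g * (h * Z * h) * g) ^ (-r : ℤ) : Aˣ) * (h * e)) := by
        push_cast
        rw [add_comm, zpow_one_add, Units.val_mul, mul_assoc e, mul_assoc _ _ e, hu, mul_smul_comm,
          mul_smul_comm, Units.val_mul, Units.val_mul, ← mul_assoc e, ← mul_assoc e, ← mul_assoc e,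
          e_h R, zpow_one, mul_assoc (_ * (Z : A)), ← mul_assoc (h : A), L.commute_X_zpow hhD,
          mul_assoc (e * f), ← hZ]
        simp only [mul_assoc]
      rw [this]
      exact Submodule.smul_mem _ _ h1
    refine ⟨hP, ?_⟩
    have hYh : ((h * Z * h : Aˣ) : A) * h
        = h * Z + (z * laminv) • (h * Z * f) - z • ((h * Z * h : Aˣ) : A) := by
      rw [Units.val_mul, mul_assoc, L'.g_sq]
      simp only [mul_add, mul_sub, mul_smul_comm, mul_one, Units.val_mul]
    have h1 : e * ((h * Z * h) ^ (r : ℤ) : Aˣ) * h * Z * e ∈ corner C e := by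
      rw [mul_assoc _ _ e, L.comm_e _ L'.Y_mem, ← mul_assoc]
      exact mul_mem_corner_of_mul_mem (ih r le_rfl).2
        (by rw [← L.comm_e _ L'.Y_mem]; exact mul_mem_corner L'.Y_mem self_mem_corner)
    have h2 := e_mul_mul_e_mem_corner L R (Y_pow_mul_mem L' (L'.g_Y_zpow_e_mem hf 1) r)
    have := sub_mem (add_mem h1 (Submodule.smul_mem _ (z * laminv) h2)) (Submodule.smul_mem _ z hP)
    convert this using 1
    push_cast
    rw [zpow_add_one, Units.val_mul, mul_assoc e, mul_assoc _ _ (h : A), hYh]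
    simp only [mul_add, mul_sub, add_mul, sub_mul, mul_smul_comm, smul_mul_assoc, mul_assoc,
      zpow_one]

end Step
end Level

theorem adjoin_le_of_mul_mem {S A : Type*} [CommRing S] [Ring A] [Algebra S A] {s : Set A}
    {N : Submodule S A} (h1 : (1 : A) ∈ N) (h : ∀ y ∈ s, ∀ m ∈ N, m * y ∈ N) :
    (Algebra.adjoin S s).toSubmodule ≤ N := by
  intro y hy
  have key : ∀ m ∈ N, m * y ∈ N := by
    induction hy using Algebra.adjoin_induction with
    | mem y hy => exact h y hy
    | algebraMap r =>
      intro m hm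
      rw [← Algebra.commutes, ← Algebra.smul_def]
      exact N.smul_mem r hm
    | add x y _ _ hx hy => intro m hm; rw [mul_add]; exact add_mem (hx m hm) (hy m hm)
    | mul x y _ _ hx hy => intro m hm; rw [← mul_assoc]; exact hy _ (hx m hm)
  simpa using key 1 h1

theorem adjoin_commute {S A : Type*} [CommRing S] [Ring A] [Algebra S A] {s : Set A} {v : A}
    (h : ∀ y ∈ s, y * v = v * y) {c : A} (hc : c ∈ Algebra.adjoin S s) : c * v = v * c := by
  have : Algebra.adjoin S s ≤ Subalgebra.centralizer S {v} :=
    Algebra.adjoin_le fun y hy ↦ by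
      simpa [Subalgebra.mem_centralizer_iff, Set.mem_centralizer_iff] using (h y hy).symm
  simpa [Subalgebra.mem_centralizer_iff, eq_comm] using this hc

section Step
variable {S A : Type*} [CommRing S] [Ring A] [Algebra S A]
  {lam laminv del z : S} {C' C D : Subalgebra S A} {Y Z h g : Aˣ} {f e : A}

theorem Level.adjoin_le_bispan (L : Level lam laminv del z C D Y g e)
    (hP : ∀ r : ℤ, e * (Y ^ r : Aˣ) * e ∈ bispan D {e})
    {T : Set A} (hT : (D.toSubmodule : Submodule S A) ≤ bispan C T)
    (hgood : ∀ t ∈ T, ∀ χ ∈ ({e, (g : A)} : Set A), ∀ ξ ∈ ({e, (g : A)} : Set A),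
      χ * t * ξ ∈ bispan D (chiSet Y g e))
    {s : Set A} (hs : ∀ y ∈ s, y ∈ D ∨ y = g ∨ y = (g⁻¹ : Aˣ) ∨ y = e) :
    (Algebra.adjoin S s).toSubmodule ≤ bispan D (chiSet Y g e) := by
  refine adjoin_le_of_mul_mem Level.one_mem_bispan fun y hy m hm ↦ ?_
  have hg := L.mul_mem_of_forall hP hT hgood (Or.inr rfl) hm
  have he := L.mul_mem_of_forall hP hT hgood (Or.inl rfl) hm
  obtain hy | rfl | rfl | rfl := hs y hy
  · exact mul_mem_bispan_right hy hm
  · exact hg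
  · rw [L.g_inv, mul_add, mul_sub, mul_smul_comm, mul_smul_comm, mul_one]
    exact add_mem (sub_mem hg (Submodule.smul_mem _ _ he)) (Submodule.smul_mem _ _ hm)
  · exact he

variable (L' : Level lam laminv del z C' C Z h f) (R : Tangle lam h g f e)

theorem Tangle.braid_val (R : Tangle lam h g f e) : (g : A) * h * g = h * g * h := by
  exact_mod_cast congrArg Units.val R.braid

include L' R in
/-- The relations at one level follow from those at the level below. -/
theorem Level.succ (hCD : C ≤ D) (hh : (h : A) ∈ D) (hh' : ((h⁻¹ : Aˣ) : A) ∈ D)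
    (hD : (D.toSubmodule : Submodule S A) ≤ bispan C (chiSet Z h f))
    (comm_g : ∀ c ∈ C, c * g = g * c) (comm_e : ∀ c ∈ C, c * e = e * c)
    (idem : e * e = del • e) (skein : (g : A) - (g⁻¹ : Aˣ) = z • (e - 1))
    (ge : (g : A) * e = laminv • e) (eg : e * (g : A) = laminv • e) :
    Level lam laminv del z C D (h * Z * h) g e := by
  have hb : (g : A) * (h * g) = h * (g * h) := by simpa only [mul_assoc] using R.braid_val
  have hb' (w : A) : (g : A) * (h * (g * w)) = h * (g * (h * w)) := by
    simpa only [mul_assoc] using congrArg (· * w) hb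
  have hgZ : (g : A) * Z = Z * g := (comm_g _ L'.Y_mem).symm
  have hgZ' (w : A) : (g : A) * (Z * w) = Z * (g * w) := by rw [← mul_assoc, hgZ, mul_assoc]
  have heZ : e * (Z : A) = Z * e := (comm_e _ L'.Y_mem).symm
  have heZ' (w : A) : e * (Z * w) = Z * (e * w) := by rw [← mul_assoc, heZ, mul_assoc]
  have hZ : (Z : A) * (h * (Z * h)) = h * (Z * (h * Z)) := by
    simpa [mul_assoc] using L'.commute_Y_X.eq
  have hZ' (w : A) : (Z : A) * (h * (Z * (h * w))) = h * (Z * (h * (Z * w))) := by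
    simpa only [mul_assoc] using congrArg (· * w) hZ
  have hX : ((g * (h * Z * h) * g : Aˣ) : A) = g * (h * (Z * (h * g))) := by simp [mul_assoc]
  have hf1 : f * (g * h) = f * e := by rw [← mul_assoc, R.fgh]
  have hf2 : (h : A) * (g * f) = e * f := by rw [← mul_assoc, R.hgf]
  have hf3 : e * (h * g) = e * f := by rw [← mul_assoc, R.ehg]
  have hf4 : (g : A) * (h * e) = f * e := by rw [← mul_assoc, R.ghe]
  have hf5 (w : A) : f * (g * (h * w)) = f * (e * w) := by
    simpa only [mul_assoc] using congrArg (· * w) hf1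
  have hf6 (w : A) : e * (h * (g * w)) = e * (f * w) := by
    simpa only [mul_assoc] using congrArg (· * w) hf3
  have hf7 (w : A) : (g : A) * (h * (e * w)) = f * (e * w) := by
    simpa only [mul_assoc] using congrArg (· * w) hf4
  have hu (w : A) : f * (Z * (h * (Z * w))) = laminv • (f * w) := by
    simpa [mul_assoc] using congrArg (· * w) L'.unwrap_left
  have hu' (w : A) : (Z : A) * (h * (Z * (f * w))) = laminv • (f * w) := by
    simpa [mul_assoc] using congrArg (· * w) L'.unwrap_right
  have hefe : e * (f * e) = e := by rw [← mul_assoc, R.efe]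
  have hXC (c : A) (hc : c ∈ C) :
      Commute c ((g * (h * Z * h) * g : Aˣ) : A) := by
    have h1 : Commute c (g : A) := comm_g c hc
    have h2 : Commute c ((h * Z * h : Aˣ) : A) := L'.comm_X c hc
    exact (h1.mul_right h2).mul_right h1
  have hXh : Commute (h : A) ((g * (h * Z * h) * g : Aˣ) : A) := by
    change _ = _
    rw [hX]
    simp only [mul_assoc]
    rw [← hb', hgZ', hb]
  have hXf : Commute f ((g * (h * Z * h) * g : Aˣ) : A) := by
    change _ = _
    rw [hX, hf5, heZ', hf3, ← heZ']
    simp only [mul_assoc]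
    rw [hf2, ← heZ', hf7]
  have hXY : Commute ((h * Z * h : Aˣ) : A) ((g * (h * Z * h) * g : Aˣ) : A) := by
    change _ = _
    rw [hX]
    simp only [Units.val_mul, mul_assoc]
    trans (h : A) * (g * (Z * (h * (Z * (h * (g * h))))))
    · rw [← hb', hgZ', hb, ← hgZ']
    · rw [← hb' (Z * h), ← hgZ', hgZ' h, hb', ← hZ']
  refine ⟨L'.lam_mul, L'.scalar_skein, hCD, ?_, ?_, L'.comm_X, comm_g, comm_e, fun d hd ↦ ?_,
    idem, skein, ge, eg, ?_, ?_⟩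
  · simpa using mul_mem (mul_mem hh (hCD L'.Y_mem)) hh
  · simpa using mul_mem hh' (mul_mem (hCD L'.Y_inv_mem) hh')
  · rw [← sub_eq_zero]
    refine map_mem_of_mem_bispan (N := ⊥) (LinearMap.mulRight S _ - LinearMap.mulLeft S _)
      (fun a ha b hb t ht ↦ ?_) (hD hd)
    have ht' : Commute t ((g * (h * Z * h) * g : Aˣ) : A) := by
      rcases ht with (rfl | rfl) | ⟨r, rfl⟩
      exacts [hXf, hXh, hXY.units_zpow_left r]
    rw [Submodule.mem_bot]
    exact sub_eq_zero.2 (((hXC a ha).mul_left ht').mul_left (hXC b hb)).eq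
  · simp only [Units.val_mul, mul_assoc]
    rw [← hb', ← hgZ', hgZ' h, hf6, hu, hf1, mul_smul_comm, hefe]
  · simp only [Units.val_mul, mul_assoc]
    rw [← hb', ← hgZ', hgZ' (h * e), hf4, hu', mul_smul_comm, mul_smul_comm, ← mul_assoc (g : A),
      ← mul_assoc, ← mul_assoc (h : A), R.hgf, R.efe]

include L' R in
/-- Spanning elements multiplied around a spanning element of the level below. -/
theorem mul_chiSet_mul_mem (L : Level lam laminv del z C D (h * Z * h) g e) (hf : f ∈ D)
    (hh : (h : A) ∈ D) (hh' : ((h⁻¹ : Aˣ) : A) ∈ D)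
    (hP : ∀ r : ℤ, e * ((h * Z * h) ^ r : Aˣ) * e ∈ bispan D {e}) {t χ ξ : A}
    (ht : t ∈ chiSet Z h f) (hχ : χ ∈ ({e, (g : A)} : Set A)) (hξ : ξ ∈ ({e, (g : A)} : Set A)) :
    χ * t * ξ ∈ bispan D (chiSet (h * Z * h) g e) := by
  have he : e ∈ bispan D (chiSet (h * Z * h) g e) := Level.e_mem
  have hg : (g : A) ∈ bispan D (chiSet (h * Z * h) g e) := Level.g_mem
  have efg : e * f * g = e * (h⁻¹ : Aˣ) := by
    rw [← R.ehg, mul_assoc, L.g_sq, L'.g_inv]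
    simp only [mul_add, mul_sub, mul_smul_comm, mul_one, R.ehg, R.ehe, smul_smul, mul_assoc z,
      mul_comm laminv, L.lam_mul]
    abel
  have gfe : (g : A) * f * e = (h⁻¹ : Aˣ) * e := by
    rw [mul_assoc, ← R.ghe, ← mul_assoc, ← mul_assoc, L.g_sq, L'.g_inv]
    simp only [add_mul, sub_mul, smul_mul_assoc, one_mul, R.ghe, R.ehe, smul_smul, mul_assoc z,
      mul_comm laminv, L.lam_mul, mul_one]
    abel
  have gf : (g : A) * f = (h⁻¹ : Aˣ) * (e * f) := by
    rw [← R.hgf, mul_assoc, Units.inv_mul_cancel_left]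
  rcases ht with (rfl | rfl) | ⟨r, rfl⟩
  · rcases hχ with rfl | rfl <;> rcases hξ with rfl | rfl
    · rwa [R.efe]
    · rw [efg]; exact mul_mem_bispan_right hh' he
    · rw [gfe]; exact mul_mem_bispan_left hh' he
    · rw [gf, mul_assoc (_ : A), efg]
      exact mul_mem_bispan_left hh' (mul_mem_bispan_right hh' he)
  · rcases hχ with rfl | rfl <;> rcases hξ with rfl | rfl
    · rw [R.ehe]; exact Submodule.smul_mem _ _ he
    · rw [R.ehg]; exact mul_mem_bispan_right hf he
    · rw [R.ghe]; exact mul_mem_bispan_left hf he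
    · rw [R.braid_val]; exact mul_mem_bispan_right hh (mul_mem_bispan_left hh hg)
  · exact L.mul_Y_zpow_mul_mem hP r hχ hξ

end Step

/-- Elements of an algebra satisfying the relations of the affine BMW algebra on `n` strands. -/
structure Rels {S A : Type*} [CommRing S] [Ring A] [Algebra S A] (lam laminv del z : S)
    (q : ℕ → S) (n : ℕ) (x : Aˣ) (g : ℕ → Aˣ) (e : ℕ → A) : Prop where
  lam_mul : lam * laminv = 1
  scalar_skein : laminv - lam = z * (del - 1)
  idem (i : ℕ) (h : 1 ≤ i ∧ i < n) : e i * e i = del • e i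
  braid (i : ℕ) (h : 1 ≤ i ∧ i + 1 < n) : g (i + 1) * g i * g (i + 1) = g i * g (i + 1) * g i
  comm_gg (i j : ℕ) (h : 1 ≤ i ∧ i + 2 ≤ j ∧ j < n) : (g i : A) * g j = g j * g i
  xbraid (h : 1 < n) : (x : A) * g 1 * x * g 1 = g 1 * x * g 1 * x
  comm_xg (j : ℕ) (h : 2 ≤ j ∧ j < n) : (x : A) * g j = g j * x
  comm_ge (i j : ℕ) (h : 1 ≤ i ∧ i + 2 ≤ j ∧ j < n) : (g i : A) * e j = e j * g i
  comm_eg (i j : ℕ) (h : 1 ≤ i ∧ i + 2 ≤ j ∧ j < n) : e i * (g j : A) = g j * e i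
  comm_ee (i j : ℕ) (h : 1 ≤ i ∧ i + 2 ≤ j ∧ j < n) : e i * e j = e j * e i
  comm_xe (j : ℕ) (h : 2 ≤ j ∧ j < n) : (x : A) * e j = e j * x
  tangle (i : ℕ) (h : 1 ≤ i ∧ i + 1 < n) : Tangle lam (g i) (g (i + 1)) (e i) (e (i + 1))
  tangle_q (r : ℕ) (hr : 1 ≤ r) (h : 1 < n) : e 1 * (x : A) ^ r * e 1 = q r • e 1
  skein (i : ℕ) (h : 1 ≤ i ∧ i < n) : (g i : A) - ((g i)⁻¹ : Aˣ) = z • (e i - 1)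
  ge (i : ℕ) (h : 1 ≤ i ∧ i < n) : (g i : A) * e i = laminv • e i
  eg (i : ℕ) (h : 1 ≤ i ∧ i < n) : e i * (g i : A) = laminv • e i
  unwrap_left (h : 1 < n) : e 1 * x * g 1 * x = laminv • e 1
  unwrap_right (h : 1 < n) : (x : A) * g 1 * x * e 1 = laminv • e 1

section Tower
variable (S : Type*) {A : Type*} [CommRing S] [Ring A] [Algebra S A]

/-- Generators of the subalgebra on the first `k + 1` strands. -/
def towerGens (x : Aˣ) (g : ℕ → Aˣ) (e : ℕ → A) (k : ℕ) : Set A :=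
  {(x : A), ((x⁻¹ : Aˣ) : A)} ∪
    {y : A | ∃ i : ℕ, 1 ≤ i ∧ i ≤ k ∧ (y = g i ∨ y = ((g i)⁻¹ : Aˣ) ∨ y = e i)}

/-- The subalgebra on the first `k` strands, trivial for `k = 0`. -/
def tower (x : Aˣ) (g : ℕ → Aˣ) (e : ℕ → A) : ℕ → Subalgebra S A
  | 0 => ⊥
  | k + 1 => Algebra.adjoin S (towerGens x g e k)

/-- The element `x_{k+1}`, as a unit. -/
def xunit (x : Aˣ) (g : ℕ → Aˣ) : ℕ → Aˣ
  | 0 => x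
  | k + 1 => g (k + 1) * xunit x g k * g (k + 1)

variable {S} {x : Aˣ} {g : ℕ → Aˣ} {e : ℕ → A}

theorem x_mem_tower (k : ℕ) : (x : A) ∈ tower S x g e (k + 1) :=
  Algebra.subset_adjoin (by simp [towerGens])

theorem x_inv_mem_tower (k : ℕ) : ((x⁻¹ : Aˣ) : A) ∈ tower S x g e (k + 1) :=
  Algebra.subset_adjoin (by simp [towerGens])

theorem g_mem_tower {i k : ℕ} (h : 1 ≤ i ∧ i ≤ k) : (g i : A) ∈ tower S x g e (k + 1) :=
  Algebra.subset_adjoin (Or.inr ⟨i, h.1, h.2, by simp⟩)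

theorem g_inv_mem_tower {i k : ℕ} (h : 1 ≤ i ∧ i ≤ k) :
    (((g i)⁻¹ : Aˣ) : A) ∈ tower S x g e (k + 1) :=
  Algebra.subset_adjoin (Or.inr ⟨i, h.1, h.2, by simp⟩)

theorem e_mem_tower {i k : ℕ} (h : 1 ≤ i ∧ i ≤ k) : e i ∈ tower S x g e (k + 1) :=
  Algebra.subset_adjoin (Or.inr ⟨i, h.1, h.2, by simp⟩)

theorem tower_le_succ (k : ℕ) : tower S x g e k ≤ tower S x g e (k + 1) := by
  cases k with
  | zero => exact bot_le
  | succ k =>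
    refine Algebra.adjoin_mono (Set.union_subset_union_right _ ?_)
    rintro y ⟨i, hi, hik, hy⟩
    exact ⟨i, hi, by omega, hy⟩

theorem mem_tower_or {k : ℕ} {y : A} (hy : y ∈ towerGens x g e (k + 1)) :
    y ∈ tower S x g e (k + 1) ∨ y = g (k + 1) ∨ y = ((g (k + 1))⁻¹ : Aˣ) ∨ y = e (k + 1) := by
  obtain (rfl | rfl) | ⟨i, hi, hik, hy⟩ := hy
  · exact Or.inl (x_mem_tower k)
  · exact Or.inl (x_inv_mem_tower k)
  obtain rfl | hik := hik.eq_or_lt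
  · exact Or.inr hy
  · exact Or.inl (Algebra.subset_adjoin (Or.inr ⟨i, hi, by omega, hy⟩))

namespace Rels
variable {lam laminv del z : S} {q : ℕ → S} {n : ℕ} (R : Rels lam laminv del z q n x g e)
include R

omit R in
theorem commute_tower {k : ℕ} {v : A} (hx : 1 ≤ k → Commute (x : A) v)
    (hg : ∀ i, 1 ≤ i → i < k → Commute (g i : A) v) (he : ∀ i, 1 ≤ i → i < k → Commute (e i) v)
    {c : A} (hc : c ∈ tower S x g e k) : c * v = v * c := by
  cases k with
  | zero =>
    obtain ⟨s, rfl⟩ := Algebra.mem_bot.1 hc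
    exact Algebra.commutes s v
  | succ k =>
    refine adjoin_commute ?_ hc
    rintro y ((rfl | rfl) | ⟨i, hi, hik, rfl | rfl | rfl⟩)
    · exact (hx (by omega)).eq
    · exact (hx (by omega)).units_inv_left.eq
    · exact (hg i hi (by omega)).eq
    · exact (hg i hi (by omega)).units_inv_left.eq
    · exact (he i hi (by omega)).eq

theorem comm_tower_g {k : ℕ} (hk : k + 1 < n) {c : A} (hc : c ∈ tower S x g e k) :
    c * g (k + 1) = g (k + 1) * c :=
  commute_tower (fun h ↦ R.comm_xg _ (by omega)) (fun i _ _ ↦ R.comm_gg i _ (by omega))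
    (fun i _ _ ↦ R.comm_eg i _ (by omega)) hc

theorem comm_tower_e {k : ℕ} (hk : k + 1 < n) {c : A} (hc : c ∈ tower S x g e k) :
    c * e (k + 1) = e (k + 1) * c :=
  commute_tower (fun h ↦ R.comm_xe _ (by omega)) (fun i _ _ ↦ R.comm_ge i _ (by omega))
    (fun i _ _ ↦ R.comm_ee i _ (by omega)) hc

theorem level_one (hn : 1 < n) :
    Level lam laminv del z (tower S x g e 0) (tower S x g e 1) x (g 1) (e 1) where
  lam_mul := R.lam_mul
  scalar_skein := R.scalar_skein
  le := tower_le_succ 0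
  Y_mem := x_mem_tower 0
  Y_inv_mem := x_inv_mem_tower 0
  comm_Y _ hc := by
    obtain ⟨s, rfl⟩ := Algebra.mem_bot.1 hc
    exact Algebra.commutes s _
  comm_g _ hc := R.comm_tower_g hn hc
  comm_e _ hc := R.comm_tower_e hn hc
  comm_X d hd := by
    have h : Commute (x : A) (g 1 * x * g 1 : Aˣ) := by
      change _ = _
      simpa [mul_assoc] using R.xbraid hn
    refine adjoin_commute ?_ hd
    rintro y ((rfl | rfl) | ⟨i, hi, hik, -⟩)
    · exact h.eq
    · exact h.units_inv_left.eq
    · exact absurd (hi.trans hik) (by decide)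
  idem := R.idem 1 (by omega)
  skein := R.skein 1 (by omega)
  ge := R.ge 1 (by omega)
  eg := R.eg 1 (by omega)
  unwrap_left := by simpa [mul_assoc] using R.unwrap_left hn
  unwrap_right := by simpa [mul_assoc] using R.unwrap_right hn

theorem e_x_zpow_e_mem (hn : 1 < n) (r : ℤ) :
    e 1 * (x ^ r : Aˣ) * e 1 ∈ corner (tower S x g e 0) (e 1) := by
  refine (R.level_one hn).e_Y_zpow_e_mem (fun r ↦ ?_) r
  obtain _ | r := r
  · simpa [R.idem 1 (by omega)] using Submodule.smul_mem _ _ self_mem_corner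
  · have := R.tangle_q (r + 1) (by omega) hn
    rw [zpow_natCast, Units.val_pow_eq_pow_val, this]
    exact Submodule.smul_mem _ _ self_mem_corner

omit R in
theorem tower_one_le :
    ((tower S x g e 1).toSubmodule : Submodule S A) ≤
      bispan (tower S x g e 0) (Set.range fun r : ℤ ↦ ((x ^ r : Aˣ) : A)) := by
  have key (s : ℤ) (m : A)
      (hm : m ∈ bispan (tower S x g e 0) (Set.range fun r : ℤ ↦ ((x ^ r : Aˣ) : A))) :
      m * (x ^ s : Aˣ) ∈ bispan (tower S x g e 0) (Set.range fun r : ℤ ↦ ((x ^ r : Aˣ) : A)) := by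
    refine map_mem_of_mem_bispan (LinearMap.mulRight S _) (fun a ha b hb t ht ↦ ?_) hm
    obtain ⟨r, rfl⟩ := ht
    obtain ⟨u, rfl⟩ := Algebra.mem_bot.1 hb
    have h : a * (x ^ r : Aˣ) * algebraMap S A u * (x ^ s : Aˣ) =
        a * (x ^ (r + s) : Aˣ) * algebraMap S A u := by
      rw [mul_assoc _ (algebraMap S A u), Algebra.commutes, ← mul_assoc, mul_assoc a,
        ← Units.val_mul, ← zpow_add]
    change a * (x ^ r : Aˣ) * algebraMap S A u * (x ^ s : Aˣ) ∈ _
    rw [h]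
    exact mul_mul_mem_bispan ha ⟨r + s, rfl⟩ hb
  refine adjoin_le_of_mul_mem (mem_bispan ⟨0, by simp⟩) ?_
  rintro y ((rfl | rfl) | ⟨i, hi, hik, -⟩) m hm
  · simpa using key 1 m hm
  · simpa using key (-1) m hm
  · exact absurd (hi.trans hik) (by decide)

/-- The bimodule decomposition, together with the facts carried along the induction. -/
theorem level_and_span (k : ℕ) (hk : k + 1 < n) :
    Level lam laminv del z (tower S x g e k) (tower S x g e (k + 1)) (xunit x g k)
        (g (k + 1)) (e (k + 1)) ∧
      (∀ r : ℤ, e (k + 1) * (xunit x g k ^ r : Aˣ) * e (k + 1) ∈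
        corner (tower S x g e k) (e (k + 1))) ∧
      ((tower S x g e (k + 2)).toSubmodule : Submodule S A) ≤
        bispan (tower S x g e (k + 1)) (chiSet (xunit x g k) (g (k + 1)) (e (k + 1))) := by
  induction k with
  | zero =>
    have L := R.level_one hk
    have hP := R.e_x_zpow_e_mem hk
    have hP' (r : ℤ) := corner_le_bispan L.le _ (hP r)
    refine ⟨L, hP, L.adjoin_le_bispan hP' tower_one_le ?_ fun y hy ↦ mem_tower_or hy⟩
    rintro _ ⟨r, rfl⟩ χ hχ ξ hξ
    exact L.mul_Y_zpow_mul_mem hP' r hχ hξ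
  | succ k ih =>
    obtain ⟨L', hP', hspan⟩ := ih (by omega)
    have hh : (g (k + 1) : A) ∈ tower S x g e (k + 2) := g_mem_tower (by omega)
    have hh' : (((g (k + 1))⁻¹ : Aˣ) : A) ∈ tower S x g e (k + 2) := g_inv_mem_tower (by omega)
    have hf : e (k + 1) ∈ tower S x g e (k + 2) := e_mem_tower (by omega)
    have T := R.tangle (k + 1) (by omega)
    have L := L'.succ T (tower_le_succ (k + 1)) hh hh' hspan (fun c ↦ R.comm_tower_g hk)
      (fun c ↦ R.comm_tower_e hk) (R.idem _ (by omega)) (R.skein _ (by omega))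
      (R.ge _ (by omega)) (R.eg _ (by omega))
    have hP := L.e_Y_zpow_e_mem fun r ↦ (e_Y_pow_e_mem L' L T
      (fun r ↦ corner_le_bispan L'.le _ (hP' r)) hf hh r r le_rfl).1
    have hP2 (r : ℤ) := corner_le_bispan L.le _ (hP r)
    exact ⟨L, hP, L.adjoin_le_bispan hP2 hspan (fun t ht χ hχ ξ hξ ↦
      mul_chiSet_mul_mem L' T L hf hh hh' hP2 ht hχ hξ) fun y hy ↦ mem_tower_or hy⟩

end Rels
end Tower

section Presentation
variable {S : Type*} [CommRing S] (lam laminv del z : S) (q : ℕ → S) (n : ℕ)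

theorem mk_rel {a b : FreeAlgebra S (Gen n)} (h : Rel S lam laminv del z q n a b) :
    RingQuot.mkAlgHom S (Rel S lam laminv del z q n) a =
      RingQuot.mkAlgHom S (Rel S lam laminv del z q n) b :=
  RingQuot.mkAlgHom_rel S h

/-- The generator `x₁` as a unit. -/
noncomputable def axUnit : (Alg S lam laminv del z q n)ˣ where
  val := ax S lam laminv del z q n
  inv := axi S lam laminv del z q n
  val_inv := by simpa [ax, axi] using mk_rel lam laminv del z q n .xinv_right
  inv_val := by simpa [ax, axi] using mk_rel lam laminv del z q n .xinv_left

/-- The generator `g i` as a unit. -/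
noncomputable def agUnit (i : ℕ) : (Alg S lam laminv del z q n)ˣ where
  val := ag S lam laminv del z q n i
  inv := agi S lam laminv del z q n i
  val_inv := by
    by_cases h : 1 ≤ i ∧ i < n
    · simpa [ag, agi] using mk_rel lam laminv del z q n (.inv_right i h)
    · simp [ag, agi, FG, FGi, h]
  inv_val := by
    by_cases h : 1 ≤ i ∧ i < n
    · simpa [ag, agi] using mk_rel lam laminv del z q n (.inv_left i h)
    · simp [ag, agi, FG, FGi, h]

theorem rels_alg (hlam : lam * laminv = 1) (hskein : laminv - lam = z * (del - 1)) :
    Rels lam laminv del z q n (axUnit lam laminv del z q n) (agUnit lam laminv del z q n)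
      (ae S lam laminv del z q n) where
  lam_mul := hlam
  scalar_skein := hskein
  idem i h := by simpa [ae] using mk_rel lam laminv del z q n (.idem i h)
  braid i h := Units.ext <| by
    simpa [agUnit, ag] using (mk_rel lam laminv del z q n (.braid i h)).symm
  comm_gg i j h := by
    simpa [agUnit, ag] using mk_rel lam laminv del z q n (.comm_gg i j (by omega))
  xbraid h := by simpa [agUnit, ag, axUnit, ax] using mk_rel lam laminv del z q n (.xbraid h)
  comm_xg j h := by
    simpa [agUnit, ag, axUnit, ax] using mk_rel lam laminv del z q n (.comm_xg j h)
  comm_ge i j h := by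
    simpa [agUnit, ag, ae] using mk_rel lam laminv del z q n (.comm_ge i j (by omega))
  comm_eg i j h := by
    simpa [agUnit, ag, ae] using (mk_rel lam laminv del z q n (.comm_ge j i (by omega))).symm
  comm_ee i j h := by
    simpa [ae] using mk_rel lam laminv del z q n (.comm_ee i j (by omega))
  comm_xe j h := by
    simpa [axUnit, ax, ae] using mk_rel lam laminv del z q n (.comm_xe j h)
  tangle i h :=
    { efe := by simpa [ae] using mk_rel lam laminv del z q n (.tangle_eee_down i h)
      ehe := by
        simpa [agUnit, ag, ae] using mk_rel lam laminv del z q n (.untwist_ege_down i h)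
      ehg := by
        simpa [agUnit, ag, ae] using mk_rel lam laminv del z q n (.tangle_egg_down i h)
      ghe := by
        simpa [agUnit, ag, ae] using mk_rel lam laminv del z q n (.tangle_gge_down i h)
      hgf := by
        simpa [agUnit, ag, ae] using mk_rel lam laminv del z q n (.tangle_gge_up i h)
      fgh := by
        simpa [agUnit, ag, ae] using mk_rel lam laminv del z q n (.tangle_egg_up i h)
      braid := Units.ext <| by
        simpa [agUnit, ag] using (mk_rel lam laminv del z q n (.braid i h)).symm }
  tangle_q r hr h := by
    simpa [axUnit, ax, ae] using mk_rel lam laminv del z q n (.tangle_q r hr h)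
  skein i h := by
    simpa [agUnit, ag, agi, ae] using mk_rel lam laminv del z q n (.skein i h)
  ge i h := by simpa [agUnit, ag, ae] using mk_rel lam laminv del z q n (.untwist_ge i h)
  eg i h := by simpa [agUnit, ag, ae] using mk_rel lam laminv del z q n (.untwist_eg i h)
  unwrap_left h := by
    simpa [agUnit, ag, axUnit, ax, ae] using mk_rel lam laminv del z q n (.unwrap_left h)
  unwrap_right h := by
    simpa [agUnit, ag, axUnit, ax, ae] using mk_rel lam laminv del z q n (.unwrap_right h)

theorem val_xunit (k : ℕ) :
    (xunit (axUnit lam laminv del z q n) (agUnit lam laminv del z q n) k :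
      Alg S lam laminv del z q n) = xvar S lam laminv del z q n (k + 1) := by
  induction k with
  | zero => simp [xunit, xvar, gdesc, gasc, axUnit]
  | succ k ih =>
    rw [xunit, Units.val_mul, Units.val_mul, ih]
    simp [xvar, gdesc, gasc, agUnit, mul_assoc]

theorem inv_xunit (k : ℕ) :
    ((xunit (axUnit lam laminv del z q n) (agUnit lam laminv del z q n) k)⁻¹.val :
      Alg S lam laminv del z q n) = xvarInv S lam laminv del z q n (k + 1) := by
  induction k with
  | zero => simp [xunit, xvarInv, gidesc, giasc, axUnit]
  | succ k ih =>
    rw [xunit, mul_inv_rev, mul_inv_rev, Units.val_mul, Units.val_mul, ih]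
    simp [xvarInv, gidesc, giasc, agUnit, mul_assoc]

theorem val_xunit_zpow (k : ℕ) (r : ℤ) :
    ((xunit (axUnit lam laminv del z q n) (agUnit lam laminv del z q n) k ^ r).val :
      Alg S lam laminv del z q n) = xzpow S lam laminv del z q n (k + 1) r := by
  unfold xzpow
  split_ifs with h
  · lift r to ℕ using h
    rw [zpow_natCast, Units.val_pow_eq_pow_val, val_xunit, Int.toNat_natCast]
  · obtain ⟨m, rfl⟩ : ∃ m : ℕ, r = -m := ⟨(-r).toNat, by omega⟩
    rw [zpow_neg, zpow_natCast, ← inv_pow, Units.val_pow_eq_pow_val, inv_xunit, neg_neg,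
      Int.toNat_natCast]

theorem tower_alg_eq_top (m : ℕ) :
    tower S (axUnit lam laminv del z q (m + 1)) (agUnit lam laminv del z q (m + 1))
      (ae S lam laminv del z q (m + 1)) (m + 1) = ⊤ := by
  have hsurj := RingQuot.mkAlgHom_surjective S (Rel S lam laminv del z q (m + 1))
  rw [eq_top_iff, ← (AlgHom.range_eq_top _).2 hsurj, ← Algebra.map_top,
    ← FreeAlgebra.adjoin_range_ι, AlgHom.map_adjoin]
  refine Algebra.adjoin_le ?_
  rintro _ ⟨_, ⟨y, rfl⟩, rfl⟩
  cases y with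
  | x => exact x_mem_tower m
  | xi => exact x_inv_mem_tower m
  | g i h =>
    have := g_mem_tower (S := S) (x := axUnit lam laminv del z q (m + 1))
      (g := agUnit lam laminv del z q (m + 1)) (e := ae S lam laminv del z q (m + 1))
      (i := i) (k := m) (by omega)
    simpa [agUnit, ag, FG, h] using this
  | gi i h =>
    have := g_inv_mem_tower (S := S) (x := axUnit lam laminv del z q (m + 1))
      (g := agUnit lam laminv del z q (m + 1)) (e := ae S lam laminv del z q (m + 1))
      (i := i) (k := m) (by omega)
    simpa [agUnit, agi, FGi, h] using this
  | e i h =>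
    have := e_mem_tower (S := S) (x := axUnit lam laminv del z q (m + 1))
      (g := agUnit lam laminv del z q (m + 1)) (e := ae S lam laminv del z q (m + 1))
      (i := i) (k := m) (by omega)
    simpa [ae, FE, h] using this

end Presentation

/-- For `n ≥ 2`, every element of `Ŵ_{n,S}` is an `S`-linear combination
of elements `a · χ · b` with `a, b` in the subalgebra generated by `x₁, x₁⁻¹` and
`{g_i, g_i⁻¹, e_i : 1 ≤ i ≤ n-2}` and `χ ∈ {e_{n-1}, g_{n-1}, g_{n-1}⁻¹} ∪ {x_n^r : r ∈ ℤ}`. -/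
theorem bimodule_decomposition
    (S : Type*) [CommRing S] (lam laminv del delinv z : S) (q : ℕ → S)
    (hlam : lam * laminv = 1) (hdel : del * delinv = 1)
    (hskein : laminv - lam = z * (del - 1)) (n : ℕ) (hn : 2 ≤ n) :
    Submodule.span S
      {t : Alg S lam laminv del z q n |
        ∃ a ∈ Algebra.adjoin S
            ({ax S lam laminv del z q n, axi S lam laminv del z q n} ∪
              {y : Alg S lam laminv del z q n | ∃ i : ℕ, 1 ≤ i ∧ i + 2 ≤ n ∧
                (y = ag S lam laminv del z q n i ∨ y = agi S lam laminv del z q n i ∨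
                  y = ae S lam laminv del z q n i)}),
        ∃ b ∈ Algebra.adjoin S
            ({ax S lam laminv del z q n, axi S lam laminv del z q n} ∪
              {y : Alg S lam laminv del z q n | ∃ i : ℕ, 1 ≤ i ∧ i + 2 ≤ n ∧
                (y = ag S lam laminv del z q n i ∨ y = agi S lam laminv del z q n i ∨
                  y = ae S lam laminv del z q n i)}),
        ∃ χ ∈ ({ae S lam laminv del z q n (n - 1), ag S lam laminv del z q n (n - 1),
                agi S lam laminv del z q n (n - 1)} ∪
              {y : Alg S lam laminv del z q n | ∃ r : ℤ, y = xzpow S lam laminv del z q n n r} :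
              Set (Alg S lam laminv del z q n)),
          t = a * χ * b} = ⊤ := by
  obtain ⟨m, rfl⟩ := Nat.exists_eq_add_of_le' hn
  have key := ((rels_alg lam laminv del z q (m + 2) hlam hskein).level_and_span m (by omega)).2.2
  rw [tower_alg_eq_top, Algebra.top_toSubmodule, top_le_iff] at key
  rw [eq_top_iff, ← key]
  have hB : tower S (axUnit lam laminv del z q (m + 2)) (agUnit lam laminv del z q (m + 2))
      (ae S lam laminv del z q (m + 2)) (m + 1) = Algebra.adjoin S
        ({ax S lam laminv del z q (m + 2), axi S lam laminv del z q (m + 2)} ∪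
          {y : Alg S lam laminv del z q (m + 2) | ∃ i : ℕ, 1 ≤ i ∧ i + 2 ≤ m + 2 ∧
            (y = ag S lam laminv del z q (m + 2) i ∨ y = agi S lam laminv del z q (m + 2) i ∨
              y = ae S lam laminv del z q (m + 2) i)}) := by
    simp only [add_le_add_iff_right]
    rfl
  rw [← hB]
  refine bispan_mono le_rfl ?_
  rintro _ ((rfl | rfl) | ⟨r, rfl⟩)
  · exact Or.inl (Or.inl rfl)
  · exact Or.inl (Or.inr (Or.inl rfl))
  · exact Or.inr ⟨r, val_xunit_zpow lam laminv del z q (m + 2) (m + 1) r⟩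

end ABMW
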